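/- There exists an alternating P-bilinear map Ψ₁,₃ : F₁ × F₁ → F₂ which is 3-compatible; that is, Ψ₁,₃(x,x) = 0 for all x ∈ F₁, d₂(Ψ₁,₃(x₁,y₁)) = 3·(d₁(x₁)·y₁ − d₁(y₁)·x₁) for all x₁, y₁ ∈ F₁, and ψ̄₄(Ψ₁,₃(x₁, d₂x₂), x₂) = 3·d₁(x₁)·ψ₄(x₂) for all x₁ ∈ F₁, x₂ ∈ F₂. -/

import Mathlib

open QuadraticMap LinearMap Submodule Function

/-- A bilinear family `t` whose values all lie in the range of an injective linear map `e` lifts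
to a bilinear map through `e`. -/
theorem exists_bilinear_lift {R A B M N : Type*} [CommRing R]
    [AddCommGroup A] [Module R A] [AddCommGroup B] [Module R B]
    [AddCommGroup M] [Module R M] [AddCommGroup N] [Module R N]
    (e : M →ₗ[R] N) (he : Function.Injective e) (t : A → B → N)
    (hadd₁ : ∀ x x' y, t (x + x') y = t x y + t x' y)
    (hsmul₁ : ∀ (r : R) x y, t (r • x) y = r • t x y)
    (hadd₂ : ∀ x y y', t x (y + y') = t x y + t x y')
    (hsmul₂ : ∀ (r : R) x y, t x (r • y) = r • t x y)
    (h : ∀ x y, ∃ m, e m = t x y) :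
    ∃ c : A →ₗ[R] B →ₗ[R] M, ∀ x y, e (c x y) = t x y := by
  choose c hc using h
  refine ⟨LinearMap.mk₂ R c ?_ ?_ ?_ ?_, hc⟩
  · intro x x' y
    exact he (by rw [map_add, hc, hc, hc, hadd₁])
  · intro r x y
    exact he (by rw [map_smul, hc, hc, hsmul₁])
  · intro x y y'
    exact he (by rw [map_add, hc, hc, hc, hadd₂])
  · intro r x y
    exact he (by rw [map_smul, hc, hc, hsmul₂])

theorem stmt_4
    (P : Type*) [CommRing P] [IsNoetherianRing P]
    (F1 F2 F3 F4 : Type*)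
    [AddCommGroup F1] [Module P F1] [Module.Free P F1] [Module.Finite P F1]
    [AddCommGroup F2] [Module P F2] [Module.Free P F2] [Module.Finite P F2]
    [AddCommGroup F3] [Module P F3] [Module.Free P F3] [Module.Finite P F3]
    [AddCommGroup F4] [Module P F4] [Module.Free P F4] [Module.Finite P F4]
    (d1 : F1 →ₗ[P] P) (d2 : F2 →ₗ[P] F1) (d3 : F3 →ₗ[P] F2) (d4 : F4 →ₗ[P] F3)
    (hd21 : ∀ x2, d1 (d2 x2) = 0) (hd32 : ∀ x3, d2 (d3 x3) = 0)
    (hd43 : ∀ x4, d3 (d4 x4) = 0)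
    (hinj4 : Function.Injective d4)
    (hex3 : LinearMap.range d4 = LinearMap.ker d3)
    (hex2 : LinearMap.range d3 = LinearMap.ker d2)
    (hex1 : LinearMap.range d2 = LinearMap.ker d1)
    (hrank : Nonempty (F4 ≃ₗ[P] P))
    (φ0 : P ≃ₗ[P] (F4 →ₗ[P] F4)) (φ1 : F1 ≃ₗ[P] (F3 →ₗ[P] F4))
    (φ2 : F2 ≃ₗ[P] (F2 →ₗ[P] F4)) (φ3 : F3 ≃ₗ[P] (F1 →ₗ[P] F4))
    (φ4 : F4 ≃ₗ[P] (P →ₗ[P] F4))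
    (hφ1 : ∀ x1 y4, φ0 (d1 x1) y4 = φ1 x1 (d4 y4))
    (hφ2 : ∀ x2 y3, φ1 (d2 x2) y3 = φ2 x2 (d3 y3))
    (hφ3 : ∀ x3 y2, φ2 (d3 x3) y2 = φ3 x3 (d2 y2))
    (hφ4 : ∀ x4 y1, φ3 (d4 x4) y1 = φ4 x4 (d1 y1))
    (ψ1d : F1 →ₗ[P] F1 →ₗ[P] F2) (hψ1alt : ∀ x1, ψ1d x1 x1 = 0)
    (ψ2d : F1 →ₗ[P] F2 →ₗ[P] F3)
    (ψ3 : F1 →ₗ[P] F3 →ₗ[P] F4)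
    (ψ4 : QuadraticMap P F2 F4)
    (hA2 : ∀ x1 x4, ψ3 x1 (d4 x4) = d1 x1 • x4)
    (hA3 : ∀ x2 x3, polar ψ4 x2 (d3 x3) = - ψ3 (d2 x2) x3)
    (hnewb : ∀ x1 y1, d2 (ψ1d x1 y1) = d1 x1 • y1 - d1 y1 • x1)
    (hbb : ∀ x1 x2, d3 (ψ2d x1 x2) = d1 x1 • x2 - ψ1d x1 (d2 x2))
    (hcc : ∀ x1 x3, d4 (ψ3 x1 x3) = d1 x1 • x3 - ψ2d x1 (d3 x3))
    (hdd : ∀ x2, d4 (ψ4 x2) = ψ2d (d2 x2) x2)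
    (hiso1 : Function.Bijective ψ3)
    (hiso2 : Function.Bijective (polarBilin ψ4))
    (hiso3 : Function.Bijective ψ3.flip)
    : ∃ Ψ13 : F1 →ₗ[P] F1 →ₗ[P] F2,
      (∀ x1, Ψ13 x1 x1 = 0) ∧
      (∀ x1 y1, d2 (Ψ13 x1 y1) = (3 : ℤ) • (d1 x1 • y1 - d1 y1 • x1)) ∧
      (∀ x1 x2, polar ψ4 (Ψ13 x1 (d2 x2)) x2 = (3 : ℤ) • (d1 x1 • ψ4 x2)) := by
  have hanti : ∀ x y, ψ1d y x = -ψ1d x y := fun x y =>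
    (LinearMap.IsAlt.neg hψ1alt x y).symm
  -- The trilinear map obtained by skew-symmetrizing the polarization of `y ↦ ψ2d y (ψ1d x y)`.
  let t : F1 → F1 → F1 →ₗ[P] F3 := fun x y =>
    ψ2d y ∘ₗ ψ1d x - ψ2d x ∘ₗ ψ1d y + (2 : P) • ψ2d.flip (ψ1d x y)
  have ht : ∀ x y z, t x y z =
      ψ2d y (ψ1d x z) - ψ2d x (ψ1d y z) + (2 : P) • ψ2d z (ψ1d x y) := fun _ _ _ => rfl
  have htker : ∀ x y z, d3 (t x y z) = 0 := by
    intro x y z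
    simp only [ht, map_add, map_sub, map_smul, hbb, hnewb]
    rw [hanti x y, hanti x z, hanti y z]
    module
  -- The pairing `F1 × F3 → F4` followed by `d4`, as a map into the linear forms on `F1`.
  let e : F3 →ₗ[P] F1 →ₗ[P] F3 := ψ3.flip.compr₂ d4
  have he_apply : ∀ w z, e w z = d4 (ψ3 z w) := fun _ _ => rfl
  have he : Function.Injective e := fun w w' h => hiso3.1 <| LinearMap.ext fun z =>
    hinj4 (LinearMap.congr_fun h z)
  have hlift : ∀ x y, ∃ w, e w = t x y := by
    intro x y
    have hmem : ∀ z, t x y z ∈ LinearMap.range d4 := fun z => by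
      rw [hex3]
      exact htker x y z
    let g : F1 →ₗ[P] F4 := (LinearEquiv.ofInjective d4 hinj4).symm.toLinearMap ∘ₗ
      (t x y).codRestrict (LinearMap.range d4) hmem
    obtain ⟨w, hw⟩ := hiso3.2 g
    refine ⟨w, LinearMap.ext fun z => ?_⟩
    have hwz : ψ3 z w = g z := LinearMap.congr_fun hw z
    rw [he_apply, hwz]
    exact congrArg Subtype.val ((LinearEquiv.ofInjective d4 hinj4).apply_symm_apply ⟨_, hmem z⟩)
  obtain ⟨c, hc⟩ := exists_bilinear_lift e he t
    (fun x x' y => by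
      ext z
      simp only [LinearMap.add_apply, ht, map_add]
      module)
    (fun r x y => by
      ext z
      simp only [LinearMap.smul_apply, ht, map_smul]
      module)
    (fun x y y' => by
      ext z
      simp only [LinearMap.add_apply, ht, map_add]
      module)
    (fun r x y => by
      ext z
      simp only [LinearMap.smul_apply, ht, map_smul]
      module)
    hlift
  have hcd4 : ∀ x y z, d4 (ψ3 z (c x y)) = t x y z := fun x y z =>
    LinearMap.congr_fun (hc x y) z
  have hcalt : ∀ x, c x x = 0 := fun x => he <| LinearMap.ext fun z => by
    rw [hc, ht, hψ1alt]
    simp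
  refine ⟨(3 : P) • ψ1d + c.compr₂ d3, fun x => ?_, fun x y => ?_, fun x u => ?_⟩
  · simp [hψ1alt, hcalt]
  · simp only [LinearMap.add_apply, LinearMap.smul_apply, LinearMap.compr₂_apply, map_add,
      map_smul, hnewb, hd32, add_zero]
    module
  · have hψ : ψ1d x (d2 u) = d1 x • u - d3 (ψ2d x u) := by
      rw [hbb]
      abel
    have hpolar : ∀ w, polar ψ4 (d3 w) u = -ψ3 (d2 u) w := fun w => by
      rw [polar_comm, hA3]
    have hval : polar ψ4 (((3 : P) • ψ1d + c.compr₂ d3) x (d2 u)) u =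
        (3 : P) • ((2 * d1 x) • ψ4 u + ψ3 (d2 u) (ψ2d x u)) - ψ3 (d2 u) (c x (d2 u)) := by
      simp only [LinearMap.add_apply, LinearMap.smul_apply, LinearMap.compr₂_apply, hψ,
        polar_add_left, polar_smul_left, polar_sub_left, hpolar, polar_self]
      module
    apply hinj4
    rw [hval]
    simp only [map_sub, map_add, map_smul, map_zsmul, hcd4, ht, hcc, hbb, hdd, hd21, hψ1alt,
      map_zero]
    module
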